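/- arXiv:1804.09820 — 2 statements merged into one kernel-verified Lean document; each statement's English description precedes it below -/
import Mathlib

section
/- Let n ≥ 1, let A be the adjacency matrix of an undirected, unweighted graph on n nodes without self-loops (a_{ij} ∈ {0,1}, a_{ij} = a_{ji}, a_{ii} = 0). Fix s > 0 and t ∈ ℝ, and for x, y ∈ ℝ set φ(x,y) = σ_{s,t}((1/n)·max{x,y}), where σ_{s,t}(z) = 1/(1 + e^{−s(z−t)}). For a permutation π of {1,…,n} define the likelihood ν(π) = ∏_{i<j, a_{ij}=1} φ(π_i, π_j) · ∏_{i<j, a_{ij}=0} (1 − φ(π_i, π_j)). Then a permutation π* maximizes ν(π) over all permutations of {1,…,n} if and only if π* maximizes f_∞(π) = Σ_{i,j=1}^n a_{ij} max{π_i, π_j} over all permutations of {1,…,n}. -/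
open Finset Filter
open scoped Classical

lemma sum_symm_aux {n : ℕ} (F : Fin n → Fin n → ℝ) (hF : ∀ i j, F i j = F j i) :
    ∑ i, ∑ j, F i j =
      2 * ∑ e ∈ Finset.univ.filter (fun e : Fin n × Fin n => e.1 < e.2), F e.1 e.2
        + ∑ i, F i i := by
  have h1 : ∑ e ∈ Finset.univ.filter (fun e : Fin n × Fin n => e.1 < e.2), F e.1 e.2
      = ∑ i, ∑ j, if i < j then F i j else 0 := by
    rw [Finset.sum_filter, Fintype.sum_prod_type]
  have h2 : (∑ i, ∑ j, if i < j then F i j else 0) = ∑ i, ∑ j, if j < i then F i j else 0 := by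
    rw [Finset.sum_comm]
    refine Finset.sum_congr rfl fun i _ => Finset.sum_congr rfl fun j _ => ?_
    rw [hF]
  have h3 : ∑ i, F i i = ∑ i, ∑ j, if i = j then F i j else 0 := by
    simp
  rw [h1, two_mul]
  nth_rewrite 2 [h2]
  rw [h3, ← Finset.sum_add_distrib, ← Finset.sum_add_distrib]
  refine Finset.sum_congr rfl fun i _ => ?_
  rw [← Finset.sum_add_distrib, ← Finset.sum_add_distrib]
  refine Finset.sum_congr rfl fun j _ => ?_
  rcases lt_trichotomy i j with h | h | h
  · simp [h, h.ne, h.not_gt]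
  · simp [h]
  · simp [h, h.ne', h.not_gt]

/-- A permutation maximizes the logistic core--periphery likelihood ν
if and only if it maximizes f_∞. -/
theorem stmt_0 (n : ℕ) (hn : 1 ≤ n) (a : Fin n → Fin n → ℝ)
    (hbin : ∀ i j, a i j = 0 ∨ a i j = 1)
    (hsym : ∀ i j, a i j = a j i)
    (hdiag : ∀ i, a i i = 0)
    (s t : ℝ) (hs : 0 < s)
    (σ : ℝ → ℝ) (hσ : ∀ z, σ z = 1 / (1 + Real.exp (-s * (z - t))))
    (φ : ℝ → ℝ → ℝ) (hφ : ∀ x y, φ x y = σ ((1 / (n : ℝ)) * max x y))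
    (ν : Equiv.Perm (Fin n) → ℝ)
    (hν : ∀ π : Equiv.Perm (Fin n), ν π =
      (∏ e ∈ Finset.univ.filter (fun e : Fin n × Fin n => e.1 < e.2 ∧ a e.1 e.2 = 1),
        φ ((π e.1 : ℝ) + 1) ((π e.2 : ℝ) + 1)) *
      (∏ e ∈ Finset.univ.filter (fun e : Fin n × Fin n => e.1 < e.2 ∧ a e.1 e.2 = 0),
        (1 - φ ((π e.1 : ℝ) + 1) ((π e.2 : ℝ) + 1))))
    (f : Equiv.Perm (Fin n) → ℝ)
    (hf : ∀ π : Equiv.Perm (Fin n),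
      f π = ∑ i, ∑ j, a i j * max ((π i : ℝ) + 1) ((π j : ℝ) + 1))
    (πs : Equiv.Perm (Fin n)) :
    (∀ π, ν π ≤ ν πs) ↔ (∀ π, f π ≤ f πs) := by
  have hn0 : (0 : ℝ) < n := by exact_mod_cast hn
  have hpos : ∀ x y, 0 < φ x y := fun x y => by
    rw [hφ, hσ]; positivity
  have hpos' : ∀ x y, 0 < 1 - φ x y := fun x y => by
    rw [hφ, hσ, sub_pos, div_lt_one (by positivity)]
    linarith [Real.exp_pos (-s * (1 / (n : ℝ) * max x y - t))]
  have hlog : ∀ x y, Real.log (φ x y) =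
      Real.log (1 - φ x y) + s * (1 / (n : ℝ) * max x y - t) := fun x y => by
    have : φ x y = (1 - φ x y) * Real.exp (s * (1 / (n : ℝ) * max x y - t)) := by
      rw [hφ, hσ, neg_mul, Real.exp_neg]
      have := Real.exp_pos (s * (1 / (n : ℝ) * max x y - t))
      field_simp
      ring
    conv_lhs => rw [this]
    rw [Real.log_mul (hpos' x y).ne' (Real.exp_pos _).ne', Real.log_exp]
  have hsymφ : ∀ x y, φ x y = φ y x := fun x y => by rw [hφ, hφ, max_comm]
  have hνpos : ∀ π, 0 < ν π := fun π => by
    rw [hν]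
    exact mul_pos (Finset.prod_pos fun _ _ => hpos _ _) (Finset.prod_pos fun _ _ => hpos' _ _)
  let L : Fin n → Fin n → ℝ := fun i j => Real.log (1 - φ ((i : ℝ) + 1) ((j : ℝ) + 1))
  let M : Fin n → Fin n → ℝ := fun i j => max ((i : ℝ) + 1) ((j : ℝ) + 1)
  have hlogν : ∀ π, Real.log (ν π) =
      ∑ e ∈ Finset.univ.filter (fun e : Fin n × Fin n => e.1 < e.2),
        (L (π e.1) (π e.2) + a e.1 e.2 * (s * (1 / (n : ℝ) * M (π e.1) (π e.2) - t))) := by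
    intro π
    rw [hν, Real.log_mul (Finset.prod_pos fun _ _ => hpos _ _).ne'
      (Finset.prod_pos fun _ _ => hpos' _ _).ne',
      Real.log_prod (fun _ _ => (hpos _ _).ne'), Real.log_prod (fun _ _ => (hpos' _ _).ne'),
      Finset.sum_filter, Finset.sum_filter, Finset.sum_filter, ← Finset.sum_add_distrib]
    refine Finset.sum_congr rfl fun e _ => ?_
    by_cases he : e.1 < e.2
    · rcases hbin e.1 e.2 with h | h
      · simp [he, h, L]
      · simp only [he, h, L, M, hlog]
        simp
    · simp [he]
  have key : ∀ π, 2 * Real.log (ν π) =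
      (∑ i, ∑ j, L i j - ∑ i, L i i - s * t * ∑ i, ∑ j, a i j) + s / n * f π := by
    intro π
    have h := sum_symm_aux (fun i j => L (π i) (π j) +
      a i j * (s * (1 / (n : ℝ) * M (π i) (π j) - t))) (fun i j => by
        simp only [L, M]; rw [hsymφ, hsym, max_comm])
    have e1 : ∑ i, ∑ j, L (π i) (π j) = ∑ i, ∑ j, L i j := by
      rw [← Equiv.sum_comp π (fun i => ∑ j, L i j)]
      exact Finset.sum_congr rfl fun i _ => Equiv.sum_comp π (fun j => L (π i) j)
    have e2 : ∑ i, L (π i) (π i) = ∑ i, L i i := Equiv.sum_comp π (fun i => L i i)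
    have e3 : ∑ i, ∑ j, a i j * (s * (1 / (n : ℝ) * M (π i) (π j) - t)) =
        s / n * f π - s * t * ∑ i, ∑ j, a i j := by
      rw [hf]
      simp only [Finset.mul_sum, ← Finset.sum_sub_distrib]
      refine Finset.sum_congr rfl fun i _ => Finset.sum_congr rfl fun j _ => ?_
      simp only [M]
      ring
    simp only [← hlogν, hdiag, zero_mul, add_zero, Finset.sum_add_distrib] at h
    rw [e1, e2, e3] at h
    linarith
  have hiff : ∀ π, ν π ≤ ν πs ↔ f π ≤ f πs := by
    intro π
    rw [← Real.log_le_log_iff (hνpos π) (hνpos πs)]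
    have hsn : 0 < s / n := by positivity
    rw [← mul_le_mul_iff_right₀ hsn (b := f π)]
    have h1 := key π
    have h2 := key πs
    constructor <;> intro h <;> linarith
  exact forall_congr' hiff
end

section
/- Let A be a symmetric n×n real matrix with nonnegative entries that is irreducible, let α > 1 and p > α, and let f_α(x) = Σ_{i,j=1}^n a_{ij} (|x_i|^α + |x_j|^α)^{1/α}. Then the maximization problem max_{x ∈ S_p^+} f_α(x) has a unique solution x*, and x* is entrywise strictly positive. -/
open Finset


noncomputable def objG {n : ℕ} (A : Matrix (Fin n) (Fin n) ℝ) (α β : ℝ) (u : Fin n → ℝ) : ℝ :=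
  ∑ i, ∑ j, A i j * ((u i) ^ β + (u j) ^ β) ^ (1 / α)

lemma g_mid {α β : ℝ} (hα : 1 < α) (hβ0 : 0 < β) (hβ1 : β < 1) {a b c d : ℝ}
    (ha : 0 ≤ a) (hb : 0 ≤ b) (hc : 0 ≤ c) (hd : 0 ≤ d) :
    (1/2) * (a ^ β + b ^ β) ^ (1 / α) + (1/2) * (c ^ β + d ^ β) ^ (1 / α) ≤
      (((1/2) * a + (1/2) * c) ^ β + ((1/2) * b + (1/2) * d) ^ β) ^ (1 / α) ∧
    (a ≠ c → (1/2) * (a ^ β + b ^ β) ^ (1 / α) + (1/2) * (c ^ β + d ^ β) ^ (1 / α) <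
      (((1/2) * a + (1/2) * c) ^ β + ((1/2) * b + (1/2) * d) ^ β) ^ (1 / α)) := by
  have hα0 : 0 < 1 / α := by positivity
  have hα1 : 1 / α ≤ 1 := by rw [div_le_one (by linarith)]; exact hα.le
  have hs := Real.strictConcaveOn_rpow hβ0 hβ1
  have hq := Real.concaveOn_rpow hα0.le hα1
  have half : (0:ℝ) < 1/2 := by norm_num
  have hsum : (1/2:ℝ) + 1/2 = 1 := by norm_num
  have h1 := hs.concaveOn.2 (Set.mem_Ici.2 ha) (Set.mem_Ici.2 hc) half.le half.le hsum
  have h2 := hs.concaveOn.2 (Set.mem_Ici.2 hb) (Set.mem_Ici.2 hd) half.le half.le hsum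
  have pa := Real.rpow_nonneg ha β
  have pb := Real.rpow_nonneg hb β
  have pc := Real.rpow_nonneg hc β
  have pd := Real.rpow_nonneg hd β
  have h3 := hq.2 (Set.mem_Ici.2 (add_nonneg pa pb)) (Set.mem_Ici.2 (add_nonneg pc pd))
    half.le half.le hsum
  simp only [smul_eq_mul] at h1 h2 h3
  refine ⟨h3.trans (Real.rpow_le_rpow (by positivity) (by linarith) hα0.le), fun hac => ?_⟩
  have h1' := hs.2 (Set.mem_Ici.2 ha) (Set.mem_Ici.2 hc) hac half half hsum
  simp only [smul_eq_mul] at h1'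
  exact h3.trans_lt (Real.rpow_lt_rpow (by positivity) (by linarith) hα0)

lemma g_scale {α β : ℝ} (hα : 1 < α) (hβ0 : 0 < β) (hβ1 : β < 1) {a b a' b' t : ℝ}
    (ha : 0 ≤ a) (hb : 0 ≤ b) (ht0 : 0 ≤ t) (ht1 : t ≤ 1)
    (ha' : t * a ≤ a') (hb' : t * b ≤ b') :
    t * (a ^ β + b ^ β) ^ (1 / α) ≤ (a' ^ β + b' ^ β) ^ (1 / α) := by
  have hα0 : 0 < 1 / α := by positivity
  have hα1 : 1 / α ≤ 1 := by rw [div_le_one (by linarith)]; exact hα.le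
  have pow1 : ∀ r : ℝ, 0 < r → r ≤ 1 → t ≤ t ^ r := fun r hr hr1 => by
    rcases ht0.eq_or_lt with h | h
    · rw [← h, Real.zero_rpow hr.ne']
    · exact Real.self_le_rpow_of_le_one ht0 ht1 hr1
  have key : ∀ x x' : ℝ, 0 ≤ x → t * x ≤ x' → t * x ^ β ≤ x' ^ β := fun x x' hx h => by
    calc t * x ^ β ≤ t ^ β * x ^ β := by
          exact mul_le_mul_of_nonneg_right (pow1 β hβ0 hβ1.le) (Real.rpow_nonneg hx _)
      _ = (t * x) ^ β := (Real.mul_rpow ht0 hx).symm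
      _ ≤ x' ^ β := Real.rpow_le_rpow (by positivity) h hβ0.le
  have pa := Real.rpow_nonneg ha β
  have pb := Real.rpow_nonneg hb β
  calc t * (a ^ β + b ^ β) ^ (1 / α) ≤ t ^ (1/α) * (a ^ β + b ^ β) ^ (1 / α) :=
        mul_le_mul_of_nonneg_right (pow1 _ hα0 hα1) (by positivity)
    _ = (t * (a ^ β + b ^ β)) ^ (1/α) := (Real.mul_rpow ht0 (by positivity)).symm
    _ ≤ _ := Real.rpow_le_rpow (by positivity)
        (by linarith [key a a' ha ha', key b b' hb hb']) hα0.le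

/-- gain estimate -/
lemma g_gain {α β : ℝ} (hα : 1 < α) (hβ0 : 0 < β) (hβ1 : β < 1) {b b' t : ℝ}
    (hb : 0 ≤ b) (ht0 : 0 < t) (ht1 : t ≤ 1) (hb' : (1 - t) * b ≤ b') :
    (1 - t) * ((0:ℝ) ^ β + b ^ β) ^ (1 / α) +
      (1 - t) * (t ^ β * ((1 + b ^ β) ^ (1/α) - (b ^ β) ^ (1/α))) ≤
      (t ^ β + b' ^ β) ^ (1 / α) := by
  have hα0 : 0 < 1 / α := by positivity
  have hα1 : 1 / α ≤ 1 := by rw [div_le_one (by linarith)]; exact hα.le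
  have h := g_scale (t := 1 - t) (a := t) (a' := t) hα hβ0 hβ1 ht0.le hb (by linarith)
    (by linarith) (by nlinarith) hb'
  refine le_trans ?_ h
  rw [Real.zero_rpow hβ0.ne', zero_add, ← mul_add]
  refine mul_le_mul_of_nonneg_left ?_ (by linarith)
  have hq := Real.concaveOn_rpow hα0.le hα1
  have pb := Real.rpow_nonneg hb β
  have pt := Real.rpow_nonneg ht0.le β
  have pt1 : t ^ β ≤ 1 := Real.rpow_le_one ht0.le ht1 hβ0.le
  have h3 := hq.2 (Set.mem_Ici.2 (add_nonneg zero_le_one pb)) (Set.mem_Ici.2 pb)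
    pt (sub_nonneg.2 pt1) (by ring)
  simp only [smul_eq_mul] at h3
  have e : t ^ β * (1 + b ^ β) + (1 - t ^ β) * b ^ β = t ^ β + b ^ β := by ring
  rw [e] at h3
  linarith

lemma objG_pos {n : ℕ} (A : Matrix (Fin n) (Fin n) ℝ) (hpos : ∀ i j, 0 ≤ A i j)
    (hedge : ∀ i, ∃ j, 0 < A i j) {α β : ℝ} (hα : 1 < α) (hβ0 : 0 < β) (hβ1 : β < 1)
    (u : Fin n → ℝ) (hu : u ∈ stdSimplex ℝ (Fin n))
    (hmax : ∀ v ∈ stdSimplex ℝ (Fin n), objG A α β v ≤ objG A α β u) (i : Fin n) : 0 < u i := by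
  by_contra hcon
  have hui : u i = 0 := le_antisymm (not_lt.1 hcon) (hu.1 i)
  obtain ⟨j, hij⟩ := hedge i
  have hα0 : 0 < 1 / α := by positivity
  set δ := (1 + (u j) ^ β) ^ (1/α) - ((u j) ^ β) ^ (1/α) with hδ
  have pj := Real.rpow_nonneg (hu.1 j) β
  have hδ0 : 0 < δ := sub_pos.2 (Real.rpow_lt_rpow pj (by linarith) hα0)
  -- the key inequality
  have key : ∀ t : ℝ, 0 < t → t ≤ 1 →
      (1 - t) * objG A α β u + A i j * ((1 - t) * (t ^ β * δ)) ≤ objG A α β u := by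
    intro t ht0 ht1
    let w : Fin n → ℝ := fun a => (1 - t) * u a + t * (if a = i then 1 else 0)
    have hw : ∀ a, (1 - t) * u a ≤ w a := fun a => by
      have : 0 ≤ t * (if a = i then (1:ℝ) else 0) := by split_ifs <;> simp [ht0.le]
      simp only [w]; linarith
    have hwi : w i = t := by simp [w, hui]
    have hws : w ∈ stdSimplex ℝ (Fin n) := by
      refine ⟨fun a => le_trans (mul_nonneg (by linarith) (hu.1 a)) (hw a), ?_⟩
      simp only [w, Finset.sum_add_distrib, ← Finset.mul_sum, hu.2]
      simp
    refine le_trans ?_ (hmax w hws)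
    have hterm : ∀ a b, (1 - t) * (A a b * ((u a) ^ β + (u b) ^ β) ^ (1/α)) +
        (if a = i then (if b = j then A i j * ((1 - t) * (t ^ β * δ)) else 0) else 0) ≤
        A a b * ((w a) ^ β + (w b) ^ β) ^ (1/α) := by
      intro a b
      have gen := mul_le_mul_of_nonneg_left
        (g_scale (t := 1 - t) hα hβ0 hβ1 (hu.1 a) (hu.1 b) (by linarith)
        (by linarith) (hw a) (hw b)) (hpos a b)
      split_ifs with h1 h2
      · subst h1 h2
        have := mul_le_mul_of_nonneg_left
          (g_gain hα hβ0 hβ1 (hu.1 b) ht0 ht1 (hw b)) (hpos a b)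
        rw [hwi, hui]
        rw [← hδ] at this
        linarith
      · linarith
      · linarith
    have := Finset.sum_le_sum (s := Finset.univ) fun a _ =>
      Finset.sum_le_sum (s := Finset.univ) fun b _ => hterm a b
    simp only [Finset.sum_add_distrib, ← Finset.mul_sum] at this
    simpa [objG] using this
  set F := objG A α β u with hF
  have hF0 : 0 ≤ F := by
    refine Finset.sum_nonneg fun a _ => Finset.sum_nonneg fun b _ => mul_nonneg (hpos a b) ?_
    have := Real.rpow_nonneg (hu.1 a) β
    have := Real.rpow_nonneg (hu.1 b) β
    positivity
  -- choose t small
  have hc : 0 < A i j * δ := mul_pos hij hδ0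
  set c := A i j * δ with hcdef
  set ε := c / (2 * (F + 1) + c) with hε
  have hε0 : 0 < ε := by positivity
  have hε1 : ε ≤ 1 := by rw [hε, div_le_one (by positivity)]; linarith
  have hr : 0 < 1 - β := by linarith
  let t := min (1/2) (ε ^ (1 / (1 - β)))
  have ht0 : 0 < t := lt_min (by norm_num) (by positivity)
  have ht2 : t ≤ 1/2 := min_le_left _ _
  have ht3 : t ^ (1 - β) ≤ ε := by
    calc t ^ (1 - β) ≤ (ε ^ (1 / (1 - β))) ^ (1 - β) :=
          Real.rpow_le_rpow ht0.le (min_le_right _ _) hr.le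
      _ = ε := by rw [← Real.rpow_mul hε0.le, one_div_mul_cancel hr.ne', Real.rpow_one]
  have hk := key t ht0 (by linarith)
  have hte : t = t ^ β * t ^ (1 - β) := by
    rw [← Real.rpow_add ht0]; simp
  have htβ : 0 < t ^ β := by positivity
  have h1 : (1 - t) * (t ^ β * c) ≤ t ^ β * (t ^ (1 - β) * F) := by
    have : (1 - t) * (t ^ β * c) ≤ t * F := by rw [hcdef]; linarith
    rw [← mul_assoc (t ^ β) (t ^ (1 - β)) F, ← hte]; exact this
  have h2 : (1 - t) * c ≤ t ^ (1 - β) * F := by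
    refine le_of_mul_le_mul_left ?_ htβ
    linarith
  have h3 : t ^ (1 - β) * F ≤ ε * F := mul_le_mul_of_nonneg_right ht3 hF0
  have h4 : ε * F < c / 2 := by
    rw [hε, div_mul_eq_mul_div, div_lt_div_iff₀ (by positivity) (by norm_num)]
    nlinarith
  nlinarith

lemma objG_unique {n : ℕ} (A : Matrix (Fin n) (Fin n) ℝ) (hpos : ∀ i j, 0 ≤ A i j)
    (hedge : ∀ i, ∃ j, 0 < A i j) {α β : ℝ} (hα : 1 < α) (hβ0 : 0 < β) (hβ1 : β < 1)
    (u v : Fin n → ℝ) (hu : u ∈ stdSimplex ℝ (Fin n)) (hv : v ∈ stdSimplex ℝ (Fin n))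
    (humax : ∀ w ∈ stdSimplex ℝ (Fin n), objG A α β w ≤ objG A α β u)
    (hvmax : ∀ w ∈ stdSimplex ℝ (Fin n), objG A α β w ≤ objG A α β v) : u = v := by
  by_contra hne
  obtain ⟨i, hi⟩ := Function.ne_iff.1 hne
  obtain ⟨j, hij⟩ := hedge i
  let w : Fin n → ℝ := fun a => (1/2) * u a + (1/2) * v a
  have hw : w ∈ stdSimplex ℝ (Fin n) := by
    refine ⟨fun a => ?_, ?_⟩
    · have := hu.1 a
      have := hv.1 a
      simp only [w]; positivity
    · simp only [w, Finset.sum_add_distrib, ← Finset.mul_sum, hu.2, hv.2]; norm_num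
  have hle : ∀ a b, (1/2) * (A a b * ((u a) ^ β + (u b) ^ β) ^ (1/α)) +
      (1/2) * (A a b * ((v a) ^ β + (v b) ^ β) ^ (1/α)) ≤
      A a b * ((w a) ^ β + (w b) ^ β) ^ (1/α) := fun a b => by
    have := mul_le_mul_of_nonneg_left
      (g_mid hα hβ0 hβ1 (hu.1 a) (hu.1 b) (hv.1 a) (hv.1 b)).1 (hpos a b)
    simp only [w]; linarith
  have hlt : (1/2) * (A i j * ((u i) ^ β + (u j) ^ β) ^ (1/α)) +
      (1/2) * (A i j * ((v i) ^ β + (v j) ^ β) ^ (1/α)) <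
      A i j * ((w i) ^ β + (w j) ^ β) ^ (1/α) := by
    have := mul_lt_mul_of_pos_left
      ((g_mid hα hβ0 hβ1 (hu.1 i) (hu.1 j) (hv.1 i) (hv.1 j)).2 hi) hij
    simp only [w]; linarith
  have hs : (1/2) * objG A α β u + (1/2) * objG A α β v < objG A α β w := by
    have := Finset.sum_lt_sum (s := Finset.univ)
      (fun a _ => Finset.sum_le_sum (s := Finset.univ) fun b _ => hle a b)
      ⟨i, Finset.mem_univ i, Finset.sum_lt_sum (s := Finset.univ) (fun b _ => hle i b)
        ⟨j, Finset.mem_univ j, hlt⟩⟩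
    simp only [Finset.sum_add_distrib, ← Finset.mul_sum] at this
    exact this
  have := humax w hw
  have := hvmax w hw
  linarith

lemma edge_of_irr {n : ℕ} (A : Matrix (Fin n) (Fin n) ℝ) (hpos : ∀ i j, 0 ≤ A i j)
    (hirr : ∀ i j, ∃ k : ℕ, 0 < (A ^ k) i j) (i k : Fin n) (hik : i ≠ k) : ∃ j, 0 < A i j := by
  obtain ⟨m, hm⟩ := hirr i k
  cases m with
  | zero => simp [Matrix.one_apply, hik] at hm
  | succ m =>
    rw [pow_succ', Matrix.mul_apply] at hm
    by_contra! h
    have : ∀ j, A i j = 0 := fun j => le_antisymm (h j) (hpos i j)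
    simp [this] at hm

lemma objG_exists {n : ℕ} (hn : 0 < n) (A : Matrix (Fin n) (Fin n) ℝ) (hpos : ∀ i j, 0 ≤ A i j)
    (hirr : ∀ i j, ∃ k : ℕ, 0 < (A ^ k) i j) {α β : ℝ} (hα : 1 < α) (hβ0 : 0 < β) (hβ1 : β < 1) :
    ∃ u ∈ stdSimplex ℝ (Fin n), (∀ w ∈ stdSimplex ℝ (Fin n), objG A α β w ≤ objG A α β u) ∧
      (∀ i, 0 < u i) ∧ ∀ v ∈ stdSimplex ℝ (Fin n),
        (∀ w ∈ stdSimplex ℝ (Fin n), objG A α β w ≤ objG A α β v) → v = u := by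
  have hcont : Continuous (objG A α β) := by
    unfold objG
    refine continuous_finsetSum _ fun i _ => continuous_finsetSum _ fun j _ =>
      continuous_const.mul (Continuous.rpow_const (Continuous.add ?_ ?_) fun _ => Or.inr ?_)
    · exact (continuous_apply i).rpow_const fun _ => Or.inr hβ0.le
    · exact (continuous_apply j).rpow_const fun _ => Or.inr hβ0.le
    · positivity
  have hne : (stdSimplex ℝ (Fin n)).Nonempty := ⟨_, single_mem_stdSimplex ℝ (⟨0, hn⟩ : Fin n)⟩
  obtain ⟨u, hu, hmax⟩ := (isCompact_stdSimplex ℝ (Fin n)).exists_isMaxOn hne hcont.continuousOn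
  have hmax' : ∀ w ∈ stdSimplex ℝ (Fin n), objG A α β w ≤ objG A α β u := fun w hw => hmax hw
  refine ⟨u, hu, hmax', ?_⟩
  rcases (show n = 1 ∨ 1 < n by omega) with h1 | h1
  · subst h1
    have hv : ∀ v ∈ stdSimplex ℝ (Fin 1), ∀ i, v i = 1 := fun v hv i => by
      have := hv.2
      rw [Fin.sum_univ_one] at this
      rwa [Subsingleton.elim i 0]
    exact ⟨fun i => by rw [hv u hu i]; exact one_pos,
      fun v h _ => funext fun i => by rw [hv v h, hv u hu]⟩
  · have hedge : ∀ i, ∃ j, 0 < A i j := fun i => by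
      haveI : Nontrivial (Fin n) := Fin.nontrivial_iff_two_le.2 h1
      obtain ⟨k, hk⟩ := exists_ne i
      exact edge_of_irr A hpos hirr i k hk.symm
    exact ⟨objG_pos A hpos hedge hα hβ0 hβ1 u hu hmax', fun v hv hvm =>
      objG_unique A hpos hedge hα hβ0 hβ1 v u hv hu hvm hmax'⟩

/-- For 1 < α < p, the maximization of f_α over S_p^+ has a unique
solution, which is entrywise strictly positive. -/
theorem stmt_14 (n : ℕ) (hn : 0 < n) (A : Matrix (Fin n) (Fin n) ℝ)
    (hsym : ∀ i j, A i j = A j i) (hpos : ∀ i j, 0 ≤ A i j)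
    (hirr : ∀ i j, ∃ k : ℕ, 0 < (A ^ k) i j)
    (α p : ℝ) (hα : 1 < α) (hp : α < p) :
    ∃ xs : Fin n → ℝ,
      ((∀ i, 0 ≤ xs i) ∧ (∑ i, |xs i| ^ p) ^ (1 / p) = 1 ∧
        ∀ y : Fin n → ℝ, (∀ i, 0 ≤ y i) → (∑ i, |y i| ^ p) ^ (1 / p) = 1 →
          (∑ i, ∑ j, A i j * (|y i| ^ α + |y j| ^ α) ^ (1 / α)) ≤
            (∑ i, ∑ j, A i j * (|xs i| ^ α + |xs j| ^ α) ^ (1 / α))) ∧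
      (∀ i, 0 < xs i) ∧
      (∀ z : Fin n → ℝ,
        ((∀ i, 0 ≤ z i) ∧ (∑ i, |z i| ^ p) ^ (1 / p) = 1 ∧
          ∀ y : Fin n → ℝ, (∀ i, 0 ≤ y i) → (∑ i, |y i| ^ p) ^ (1 / p) = 1 →
            (∑ i, ∑ j, A i j * (|y i| ^ α + |y j| ^ α) ^ (1 / α)) ≤
              (∑ i, ∑ j, A i j * (|z i| ^ α + |z j| ^ α) ^ (1 / α))) →
        z = xs) := by
  have hα0 : 0 < α := by linarith
  have hp0 : 0 < p := by linarith
  have hβ0 : 0 < α / p := by positivity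
  have hβ1 : α / p < 1 := by rw [div_lt_one hp0]; exact hp
  obtain ⟨u, hu, hmax, hupos, huniq⟩ := objG_exists hn A hpos hirr hα hβ0 hβ1
  -- change of variables
  have toS : ∀ y : Fin n → ℝ, (∀ i, 0 ≤ y i) → (∑ i, |y i| ^ p) ^ (1 / p) = 1 →
      (fun i => y i ^ p) ∈ stdSimplex ℝ (Fin n) := fun y hy h => by
    refine ⟨fun i => Real.rpow_nonneg (hy i) p, ?_⟩
    have e : ∀ i, |y i| ^ p = y i ^ p := fun i => by rw [abs_of_nonneg (hy i)]
    simp only [e] at h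
    have h0 : 0 ≤ ∑ i, y i ^ p := Finset.sum_nonneg fun i _ => Real.rpow_nonneg (hy i) p
    have h2 : ((∑ i, y i ^ p) ^ (1 / p)) ^ p = 1 := by rw [h, Real.one_rpow]
    rwa [← Real.rpow_mul h0, one_div_mul_cancel hp0.ne', Real.rpow_one] at h2
  have toG : ∀ y : Fin n → ℝ, (∀ i, 0 ≤ y i) →
      (∑ i, ∑ j, A i j * (|y i| ^ α + |y j| ^ α) ^ (1 / α)) =
        objG A α (α / p) (fun i => y i ^ p) := fun y hy => by
    have e : ∀ i, (y i ^ p) ^ (α / p) = |y i| ^ α := fun i => by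
      rw [← Real.rpow_mul (hy i), mul_div_cancel₀ _ hp0.ne', abs_of_nonneg (hy i)]
    simp only [objG, e]
  have fromS : ∀ v ∈ stdSimplex ℝ (Fin n), (∀ i, 0 ≤ v i ^ (1 / p)) ∧
      (∑ i, |v i ^ (1 / p)| ^ p) ^ (1 / p) = 1 ∧ (fun i => (v i ^ (1 / p)) ^ p) = v :=
    fun v hv => by
    have e : ∀ i, (v i ^ (1 / p)) ^ p = v i := fun i => by
      rw [← Real.rpow_mul (hv.1 i), one_div_mul_cancel hp0.ne', Real.rpow_one]
    have h0 : ∀ i, 0 ≤ v i ^ (1 / p) := fun i => Real.rpow_nonneg (hv.1 i) _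
    refine ⟨h0, ?_, funext e⟩
    simp only [abs_of_nonneg (h0 _), e, hv.2, Real.one_rpow]
  obtain ⟨hx0, hx1, hx2⟩ := fromS u hu
  refine ⟨fun i => u i ^ (1 / p), ⟨hx0, hx1, fun y hy hy1 => ?_⟩,
    fun i => Real.rpow_pos_of_pos (hupos i) _, ?_⟩
  · have := hmax _ (toS y hy hy1)
    rw [toG y hy]
    refine this.trans_eq ?_
    rw [toG (fun i => u i ^ (1 / p)) hx0, hx2]
  · rintro z ⟨hz0, hz1, hz2⟩
    have hzu : (fun i => z i ^ p) = u := huniq _ (toS z hz0 hz1) fun w hw => by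
      obtain ⟨hw0, hw1, hw2⟩ := fromS w hw
      have := hz2 (fun i => w i ^ (1 / p)) hw0 hw1
      rwa [toG z hz0, toG (fun i => w i ^ (1 / p)) hw0, hw2] at this
    funext i
    rw [← hzu]
    simp only
    rw [← Real.rpow_mul (hz0 i), mul_one_div_cancel hp0.ne', Real.rpow_one]
end
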